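/- Duality of the Griffiths polynomials of q-Racah type: for all nonnegative integers i, j, x, y with i+j ≤ N and x+y ≤ N, one has G_{i,j}(x,y;c₁,c₂,c₃,c₄;N) = [Ω(i;c₁,c₂,c₃;N−j)·Λ(j;c₄,c₀,c₃,c₁;N) / (Ω(x;c₁,c₂,c₄;N−y)·Λ(y;c₃,c₀,c₄,c₁;N))]·G_{x,y}(i,j;c₁,c₂,c₄,c₃;N). (For the parameter list (c₁,c₂,c₄,c₃) the induced fifth parameter (q^{2N+3}c₁c₂c₄c₃)^{−1} equals the same c₀.) -/

import Mathlib

noncomputable section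
namespace qR

/-- q-Pochhammer symbol `(a;q)_k = ∏_{l<k} (1 - a qˡ)`. -/
def poch (q a : ℂ) (k : ℕ) : ℂ := ∏ l ∈ Finset.range k, (1 - a * q ^ l)

/-- q-binomial coefficient, zero outside `0 ≤ n ≤ N`. -/
def binom (q : ℂ) (N n : ℤ) : ℂ :=
  if 0 ≤ n ∧ n ≤ N then poch q q N.toNat / (poch q q n.toNat * poch q q (N - n).toNat) else 0

/-- Normalisation `Ω(n;c1,c2,c3;N)`; `s` and `t2` are the chosen square roots of `q` and `c2`,
so that `(q c2)^(n - N/2) = (s t2)^(2n - N)`. -/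
def Om (q s c1 c2 c3 t2 : ℂ) (N n : ℤ) : ℂ :=
  binom q N n * (1 - c2 * c3 * q ^ (2 * n + 1)) * poch q (q * c2) n.toNat
      * poch q (c1 * c2 * c3 * q ^ (N + 2)) n.toNat * poch q (q * c1) (N - n).toNat
    / ((s * t2) ^ (2 * n - N) * poch q (c2 * c3 * q ^ (n + 1)) (N + 1).toNat
        * poch q (q * c3) n.toNat)

/-- Normalised q-Racah polynomial `p_n(x;c1,c2,c3;N)`, with the convention that it
vanishes unless `0 ≤ n ≤ N` and `0 ≤ x ≤ N`. -/
def p (q s c1 c2 c3 t2 : ℂ) (N n x : ℤ) : ℂ :=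
  if 0 ≤ n ∧ n ≤ N ∧ 0 ≤ x ∧ x ≤ N then
    Om q s c1 c2 c3 t2 N n *
      ∑ k ∈ Finset.range (n.toNat + 1),
        poch q (q ^ (-n)) k * poch q (c2 * c3 * q ^ (n + 1)) k * poch q (q ^ (-x)) k
            * poch q (c1 * c2 * q ^ (x + 1)) k * q ^ k
          / (poch q (q * c2) k * poch q (c1 * c2 * c3 * q ^ (N + 2)) k
              * poch q (q ^ (-N)) k * poch q q k)
  else 0

/-- `ω_n(c) = (-1)^n c^{n/2} q^{n(n+1)/2}`, where `r` is the chosen square root of `c`. -/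
def om (q r : ℂ) (n : ℤ) : ℂ := (-1 : ℂ) ^ n * r ^ n * q ^ (n * (n + 1) / 2)

/-- `ξ_n(c1,c2) = ((qc1;q)_n/(qc2;q)_n) (c2/c1)^{n/2}`, where `t1, t2` are the chosen
square roots of `c1, c2`. -/
def xi (q c1 c2 t1 t2 : ℂ) (n : ℤ) : ℂ :=
  poch q (q * c1) n.toNat / poch q (q * c2) n.toNat * (t2 / t1) ^ n

/-- `λ(x;c) = -(1-q^{-x})(1-c q^{x+1})`. -/
def lam (q c : ℂ) (x : ℤ) : ℂ := -(1 - q ^ (-x)) * (1 - c * q ^ (x + 1))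

def PhiP (q c1 c2 c3 : ℂ) (N n : ℤ) : ℂ :=
  -c2 * q ^ (n - N) * (1 - q ^ n) * (1 - c1 * q ^ (N - n + 1)) * (1 - c2 * c3 * q ^ (n + N + 1))
      * (1 - c3 * q ^ n)
    / ((1 - c2 * c3 * q ^ (2 * n)) * (1 - c2 * c3 * q ^ (2 * n + 1)))

def PhiM (q c1 c2 c3 : ℂ) (N n : ℤ) : ℂ :=
  (1 - q ^ (n - N)) * (1 - c1 * c2 * c3 * q ^ (n + N + 2)) * (1 - c2 * q ^ (n + 1))
      * (1 - c2 * c3 * q ^ (n + 1))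
    / ((1 - c2 * c3 * q ^ (2 * n + 1)) * (1 - c2 * c3 * q ^ (2 * n + 2)))

/-- `Φ^ε(n;c1,c2,c3;N)`, where `ε = 1, -1, 0` selects `Φ⁺, Φ⁻, Φ⁰`. -/
def Phi (q c1 c2 c3 : ℂ) (N ε n : ℤ) : ℂ :=
  if ε = 1 then PhiP q c1 c2 c3 N n
  else if ε = -1 then PhiM q c1 c2 c3 N n
  else -PhiP q c1 c2 c3 N n - PhiM q c1 c2 c3 N n

/-- `λ₊(x;c1,c2,c3;N)`. -/
def lamP (q c1 c2 c3 : ℂ) (N x : ℤ) : ℂ :=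
  -(q ^ (-N - 1) / c3 - q ^ (-x)) * (1 - c1 * c2 * c3 * q ^ (N + x + 2))

/-- `λ₋(x;c1,c2,c3;N)`. -/
def lamM (q c1 c2 c3 : ℂ) (N x : ℤ) : ℂ :=
  -(q ^ (-N) - q ^ (-x)) * (1 - c1 * c2 * q ^ (N + x + 1))

def PhiPp (q sq c1 c2 c3 : ℂ) (N n : ℤ) : ℂ :=
  -sq * c2 * q ^ (2 * n - N - 1) * (1 - q ^ n) * (1 - c1 * q ^ (N - n + 1))
      * (1 - c1 * q ^ (N + 2 - n)) * (1 - c3 * q ^ n)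
    / ((1 - c2 * c3 * q ^ (2 * n)) * (1 - c2 * c3 * q ^ (2 * n + 1)))

def PhiPm (q sq c1 c2 c3 : ℂ) (N n : ℤ) : ℂ :=
  -((1 - c1 * c2 * c3 * q ^ (n + N + 2)) * (1 - c1 * c2 * c3 * q ^ (n + N + 3))
      * (1 - c2 * q ^ (n + 1)) * (1 - c2 * c3 * q ^ (n + 1)))
    / (c3 * q ^ (N + 1) * sq * (1 - c2 * c3 * q ^ (2 * n + 1)) * (1 - c2 * c3 * q ^ (2 * n + 2)))

def PhiP0 (q sq c1 c2 c3 : ℂ) (N n : ℤ) : ℂ :=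
  -PhiPp q sq c1 c2 c3 N n - PhiPm q sq c1 c2 c3 N n
    - (1 - c1 * c2 * q ^ (N + 2)) * (1 - c1 * c2 * c3 * q ^ (N + 2)) / (c3 * q ^ (N + 1) * sq)

def PhiMp (q sq c1 c2 c3 : ℂ) (N n : ℤ) : ℂ :=
  -sq * (1 - q ^ n) * (1 - c3 * q ^ n) * (1 - c2 * c3 * q ^ (n + N))
      * (1 - c2 * c3 * q ^ (n + N + 1))
    / (q ^ N * (1 - c2 * c3 * q ^ (2 * n)) * (1 - c2 * c3 * q ^ (2 * n + 1)))

def PhiMm (q sq c1 c2 c3 : ℂ) (N n : ℤ) : ℂ :=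
  -c3 * sq * q ^ N * (1 - q ^ (n - N)) * (1 - q ^ (n - N + 1)) * (1 - c2 * q ^ (n + 1))
      * (1 - c2 * c3 * q ^ (n + 1))
    / ((1 - c2 * c3 * q ^ (2 * n + 1)) * (1 - c2 * c3 * q ^ (2 * n + 2)))

def PhiM0 (q sq c1 c2 c3 : ℂ) (N n : ℤ) : ℂ :=
  -PhiMp q sq c1 c2 c3 N n - PhiMm q sq c1 c2 c3 N n - sq * (1 - c3 * q ^ N) * (q ^ (-N) - 1)

/-- Contiguity coefficient `Φ_σ^ε(n;c1,c2,c3;N)`, where `σ = 1` is the `+` and `σ = -1`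
the `-` family, `ε ∈ {1,0,-1}` selects the superscript, and `sq` is the chosen square
root of `q c2`. -/
def PhiC (q sq c1 c2 c3 : ℂ) (σ ε N n : ℤ) : ℂ :=
  if σ = 1 then
    if ε = 1 then PhiPp q sq c1 c2 c3 N n
    else if ε = -1 then PhiPm q sq c1 c2 c3 N n
    else PhiP0 q sq c1 c2 c3 N n
  else
    if ε = 1 then PhiMp q sq c1 c2 c3 N n
    else if ε = -1 then PhiMm q sq c1 c2 c3 N n
    else PhiM0 q sq c1 c2 c3 N n

def Fp (q c1 c2 : ℂ) (x : ℤ) : ℂ :=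
  c1 * c2 ^ 2 * q ^ (x + 1) * (1 - c1 * q ^ x) * (1 - q ^ x)
    / ((1 - c1 * c2 * q ^ (2 * x)) * (1 - c1 * c2 * q ^ (2 * x + 1)))

def Fm (q c1 c2 : ℂ) (x : ℤ) : ℂ :=
  c1 * c2 * q ^ (x + 1) * (1 - c2 * q ^ (x + 1)) * (1 - c1 * c2 * q ^ (x + 1))
    / ((1 - c1 * c2 * q ^ (2 * x + 1)) * (1 - c1 * c2 * q ^ (2 * x + 2)))

/-- The coefficients `A^{ε,ε'}_{i,j}(c1,c2,c3,c4;N)` for `(ε,ε') ≠ (0,0)`;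
`t2` is the chosen square root of `c2` and the fifth parameter
`c0 = (q^{2N+3} c1 c2 c3 c4)⁻¹` is computed internally. -/
def Aaux (q s c1 c2 c3 c4 t2 : ℂ) (N ε ε' i j : ℤ) : ℂ :=
  if ε' = 1 ∨ ε' = -1 then
    -c3 * q ^ (N + 1) *
        (if ε' = 1 then Fp q c4 ((q ^ (2 * N + 3) * c1 * c2 * c3 * c4)⁻¹) j
         else Fm q c4 ((q ^ (2 * N + 3) * c1 * c2 * c3 * c4)⁻¹) j) *
        PhiC q (s * t2) c1 c2 c3 ε' ε (N - j) i
  else if ε = 1 ∨ ε = -1 then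
    c3 * q ^ (N + 1) *
        (Fp q c4 ((q ^ (2 * N + 3) * c1 * c2 * c3 * c4)⁻¹) j
          + Fm q c4 ((q ^ (2 * N + 3) * c1 * c2 * c3 * c4)⁻¹) j) *
        Phi q c1 c2 c3 (N - j) ε i
  else 0

/-- The coefficients `A^{ε,ε'}_{i,j}(c1,c2,c3,c4;N)`. -/
def A (q s c1 c2 c3 c4 t2 : ℂ) (N ε ε' i j : ℤ) : ℂ :=
  if ε = 0 ∧ ε' = 0 then
    -((1 - c3 * q ^ (N + 1 - j)) * (s * t2) / (1 - c1 * c2 * q ^ (N + 2 - j)))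
          * ∑ e ∈ ({-1, 0, 1} : Finset ℤ), Aaux q s c1 c2 c3 c4 t2 N e 1 i j
      - (1 - c1 * c2 * q ^ (N + 1 - j)) / ((1 - c3 * q ^ (N - j)) * (s * t2))
          * ∑ e ∈ ({-1, 0, 1} : Finset ℤ), Aaux q s c1 c2 c3 c4 t2 N e (-1) i j
      - ∑ e ∈ ({-1, 1} : Finset ℤ), Aaux q s c1 c2 c3 c4 t2 N e 0 i j
  else Aaux q s c1 c2 c3 c4 t2 N ε ε' i j

/-- `Λ(x;c1,c2,c3,c4;N)`; `s, t1, t2, t3, t4` are the chosen square roots of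
`q, c1, c2, c3, c4`. -/
def Lam (q s c1 c2 c3 c4 t1 t2 t3 t4 : ℂ) (N x : ℤ) : ℂ :=
  (-1 : ℂ) ^ x * binom q N x * (1 - c1 * c2 * q ^ (2 * x + 1)) * poch q (q * c2) x.toNat
      * (s * t2) ^ N * (t1 * t3 / (t2 * t4)) ^ x * q ^ (x * (x - 1) / 2)
    / (poch q (q * c1) x.toNat * poch q (q ^ (x + 1) * c1 * c2) (N + 1).toNat)

/-- Tratnik polynomial of q-Racah type `T_{i,j}(x,y;c1,c2,c3,c4;N)`; the fifth parameter
`c0 = (q^{2N+3} c1 c2 c3 c4)⁻¹` and its square root `t0 = (s^{2N+3} t1 t2 t3 t4)⁻¹`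
are computed internally. -/
def T (q s c1 c2 c3 c4 t1 t2 t3 t4 : ℂ) (N i j x y : ℤ) : ℂ :=
  if 0 ≤ i ∧ 0 ≤ j ∧ i + j ≤ N then
    p q s c1 c2 c3 t2 (N - j) i x *
      p q s c3 ((q ^ (2 * N + 3) * c1 * c2 * c3 * c4)⁻¹) c4
        ((s ^ (2 * N + 3) * t1 * t2 * t3 * t4)⁻¹) (N - x) j y
  else 0

/-- Griffiths polynomial of q-Racah type `G_{i,j}(x,y;c1,c2,c3,c4;N)`; the fifth parameter
`c0 = (q^{2N+3} c1 c2 c3 c4)⁻¹` and its square root `t0 = (s^{2N+3} t1 t2 t3 t4)⁻¹`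
are computed internally. -/
def G (q s c1 c2 c3 c4 t1 t2 t3 t4 : ℂ) (N i j x y : ℤ) : ℂ :=
  if 0 ≤ i ∧ 0 ≤ j ∧ i + j ≤ N then
    ∑ a ∈ Finset.range ((min (N - j) (N - y)).toNat + 1),
      om q (t1 * t2 * t3 / t4) (a : ℤ) * p q s c1 c2 c3 t2 (N - j) i (a : ℤ) *
        p q s c3 ((q ^ (2 * N + 3) * c1 * c2 * c3 * c4)⁻¹) c4
          ((s ^ (2 * N + 3) * t1 * t2 * t3 * t4)⁻¹) (N - (a : ℤ)) j y *
        p q s c4 c2 c1 t2 (N - y) (a : ℤ) x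
  else 0

end qR

namespace qR

theorem poch_ne {q a : ℂ} {k : ℕ} (h : ∀ l : ℕ, l < k → 1 - a * q ^ l ≠ 0) :
    poch q a k ≠ 0 := by
  unfold poch
  rw [Finset.prod_ne_zero_iff]
  intro l hl
  exact h l (Finset.mem_range.mp hl)

theorem poch_vanish {q : ℂ} (hq : q ≠ 0) {n k : ℕ} (h : n < k) :
    poch q (q ^ (-(n : ℤ))) k = 0 := by
  unfold poch
  apply Finset.prod_eq_zero (Finset.mem_range.mpr h)
  rw [zpow_neg, zpow_natCast, inv_mul_cancel₀ (pow_ne_zero _ hq), sub_self]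

/-- sign-power factor -/
def sg (q : ℂ) (j : ℕ) : ℂ := (-1 : ℂ) ^ (j : ℤ) * q ^ ((j : ℤ) * ((j : ℤ) - 1) / 2)

theorem sg_succ {q : ℂ} (hq : q ≠ 0) (j : ℕ) : sg q (j + 1) = sg q j * (-q ^ j) := by
  unfold sg
  have h : (((j + 1 : ℕ) : ℤ) * (((j + 1 : ℕ) : ℤ) - 1) / 2)
      = (j : ℤ) * ((j : ℤ) - 1) / 2 + j := by
    rw [← Int.add_mul_ediv_right _ _ (by norm_num)]
    congr 1
    push_cast
    ring
  rw [h, zpow_add₀ hq]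
  push_cast
  rw [zpow_add₀ (by norm_num)]
  simp only [zpow_natCast, zpow_one]
  ring

theorem poch_succ (q a : ℂ) (k : ℕ) : poch q a (k + 1) = poch q a k * (1 - a * q ^ k) := by
  unfold poch
  rw [Finset.prod_range_succ]

theorem poch_refl {q : ℂ} (hq : q ≠ 0) (X Y : ℂ) (j : ℕ) : ∀ n : ℕ,
    X * Y * q ^ (n + j) = q → poch q X j * poch q Y n = sg q j * X ^ j * poch q Y (n + j) := by
  induction j with
  | zero => intro n h; simp [poch, sg]
  | succ j ih =>
    intro n h
    have h1 := ih (n + 1) (by linear_combination h)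
    have hX : X * q ^ j * (Y * q ^ n) = 1 := by
      apply mul_right_cancel₀ hq
      rw [one_mul]
      linear_combination h
    rw [poch_succ q Y n] at h1
    rw [poch_succ q X j, sg_succ hq, show n + (j + 1) = n + 1 + j by ring]
    have e : (1 - X * q ^ j) = -(X * q ^ j) * (1 - Y * q ^ n) := by
      linear_combination -hX
    rw [e]
    linear_combination (-(X * q ^ j)) * h1

/-- the hypergeometric sum -/
def S (q c1 c2 c3 : ℂ) (N n x : ℤ) : ℂ :=
  ∑ k ∈ Finset.range (n.toNat + 1),
        poch q (q ^ (-n)) k * poch q (c2 * c3 * q ^ (n + 1)) k * poch q (q ^ (-x)) k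
            * poch q (c1 * c2 * q ^ (x + 1)) k * q ^ k
          / (poch q (q * c2) k * poch q (c1 * c2 * c3 * q ^ (N + 2)) k
              * poch q (q ^ (-N)) k * poch q q k)

theorem S_ext {q : ℂ} (hq : q ≠ 0) (c1 c2 c3 : ℂ) (N : ℤ) (n x m : ℕ) (h : n ≤ m) :
    S q c1 c2 c3 N n x = ∑ k ∈ Finset.range (m + 1),
        poch q (q ^ (-(n : ℤ))) k * poch q (c2 * c3 * q ^ ((n : ℤ) + 1)) k
            * poch q (q ^ (-(x : ℤ))) k
            * poch q (c1 * c2 * q ^ ((x : ℤ) + 1)) k * q ^ k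
          / (poch q (q * c2) k * poch q (c1 * c2 * c3 * q ^ (N + 2)) k
              * poch q (q ^ (-N)) k * poch q q k) := by
  unfold S
  apply Finset.sum_subset
  · intro k hk
    simp only [Finset.mem_range, Int.toNat_natCast] at *
    omega
  · intro k _ hk
    simp only [Finset.mem_range, Int.toNat_natCast] at hk
    rw [poch_vanish hq (show n < k by omega)]
    simp

theorem S_symm {q : ℂ} (hq : q ≠ 0) (c1 c2 c3 : ℂ) (N : ℤ) (n x : ℕ) :
    S q c1 c2 c3 N n x = S q c3 c2 c1 N x n := by
  rw [S_ext hq c1 c2 c3 N n x (max n x) (le_max_left _ _),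
    S_ext hq c3 c2 c1 N x n (max n x) (le_max_right _ _)]
  apply Finset.sum_congr rfl
  intro k _
  rw [show c2 * c1 = c1 * c2 by ring, show c3 * c2 = c2 * c3 by ring,
    show c2 * c3 * c1 = c1 * c2 * c3 by ring]
  ring

theorem p_eq (q s c1 c2 c3 t2 : ℂ) (N : ℤ) (n x : ℕ) (hn : (n : ℤ) ≤ N) (hx : (x : ℤ) ≤ N) :
    p q s c1 c2 c3 t2 N n x = Om q s c1 c2 c3 t2 N n * S q c1 c2 c3 N n x := by
  unfold p S
  rw [if_pos ⟨by positivity, hn, by positivity, hx⟩]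

theorem Om_eq {q s c1 c2 c3 t2 : ℂ} (hst : s * t2 ≠ 0) (n u : ℕ) (N : ℤ)
    (hN : N = ((n + u : ℕ) : ℤ)) :
    Om q s c1 c2 c3 t2 N n =
      poch q q (n + u) / (poch q q n * poch q q u) * (1 - c2 * c3 * q ^ (2 * n + 1))
      * poch q (q * c2) n
      * poch q (c1 * c2 * c3 * q ^ (n + u + 2)) n * poch q (q * c1) u
      * (s * t2) ^ u / ((s * t2) ^ n * poch q (c2 * c3 * q ^ (n + 1)) (n + u + 1)
        * poch q (q * c3) n) := by
  subst hN
  unfold Om binom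
  rw [if_pos ⟨by positivity, by push_cast; omega⟩]
  rw [show ((n + u : ℕ) : ℤ) - (n : ℤ) = (u : ℤ) by push_cast; ring,
    show 2 * (n : ℤ) - ((n + u : ℕ) : ℤ) = (n : ℤ) - (u : ℤ) by push_cast; ring,
    show ((n + u : ℕ) : ℤ) + 1 = ((n + u + 1 : ℕ) : ℤ) by push_cast; ring,
    show ((n + u : ℕ) : ℤ) + 2 = ((n + u + 2 : ℕ) : ℤ) by push_cast; ring,
    show (n : ℤ) + 1 = ((n + 1 : ℕ) : ℤ) by push_cast; ring,
    show 2 * (n : ℤ) + 1 = ((2 * n + 1 : ℕ) : ℤ) by push_cast; ring,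
    zpow_sub₀ hst]
  simp only [zpow_natCast, Int.toNat_natCast]
  simp only [div_eq_mul_inv, mul_inv, inv_inv]
  ring

theorem Lam_eq (q s c1 c2 c3 c4 t1 t2 t3 t4 : ℂ) (N x w : ℕ) (hN : N = x + w) :
    Lam q s c1 c2 c3 c4 t1 t2 t3 t4 (N : ℤ) (x : ℤ) =
     poch q q N / (poch q q x * poch q q w) * sg q x * (1 - c1 * c2 * q ^ (2 * x + 1))
      * poch q (q * c2) x
      * (s * t2) ^ N * (t1 * t3 / (t2 * t4)) ^ x
    / (poch q (q * c1) x * poch q (q ^ (x + 1) * c1 * c2) (N + 1)) := by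
  unfold Lam binom sg
  rw [if_pos ⟨by positivity, by omega⟩]
  rw [show (N : ℤ) - (x : ℤ) = (w : ℤ) by omega,
    show (N : ℤ) + 1 = ((N + 1 : ℕ) : ℤ) by push_cast; ring,
    show (x : ℤ) + 1 = ((x + 1 : ℕ) : ℤ) by push_cast; ring,
    show 2 * (x : ℤ) + 1 = ((2 * x + 1 : ℕ) : ℤ) by push_cast; ring]
  simp only [zpow_natCast, Int.toNat_natCast]
  ring

theorem mono_half {s t1 t2 t3 t4 t0 : ℂ} {N j y a u v : ℕ}
    (hs0 : s ≠ 0) (h0 : t0 ≠ 0) (h1 : t1 ≠ 0) (h2 : t2 ≠ 0) (h4 : t4 ≠ 0)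
    (hr : s ^ (2 * N + 3) * t0 * t1 * t2 * t3 * t4 = 1)
    (hN : N = a + j + u) (hN' : N = a + y + v) :
    (t3 * t4 / (t0 * t1)) ^ y * (t1 * t2 * t3 / t4) ^ a * ((s * t0) ^ u / (s * t0) ^ j)
      * ((s * t2) ^ v / (s * t2) ^ a) * (t3 ^ 2 * t0 ^ 2 * t4 ^ 2 * (s ^ 2) ^ (j + u + 2)) ^ j
      * (t4 ^ 2 * t2 ^ 2 * t1 ^ 2 * (s ^ 2) ^ (a + v + 2)) ^ a
    = (s * t2) ^ (j + u) * (s * t0) ^ (j + u)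
      * (t3 ^ 2 * t4 ^ 2 * (s ^ 2) ^ (j + u + 1)) ^ (y + j)
      * (t1 ^ 3 * t2 ^ 3 * t3 * t4) ^ a * ((s ^ 2) ^ (a + (j + u) + 2)) ^ a / (s * t2) ^ a := by
  have hK : t3 * t4 / (t0 * t1)
      = t3 ^ 2 * t4 ^ 2 * (s ^ 2) ^ (j + u + 1) * (s ^ 2) ^ a * (s * t2) := by
    rw [div_eq_iff (mul_ne_zero h0 h1)]
    have : t3 * t4 = t3 * t4 * (s ^ (2 * N + 3) * t0 * t1 * t2 * t3 * t4) := by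
      rw [hr, mul_one]
    rw [this, hN]
    ring
  have hB : (t3 ^ 2 * t0 ^ 2 * t4 ^ 2 * (s ^ 2) ^ (j + u + 2))
      = (t3 ^ 2 * t4 ^ 2 * (s ^ 2) ^ (j + u + 1)) * (s * t0) ^ 2 := by ring
  have hC : t1 * t2 * t3 / t4 * (t4 ^ 2 * t2 ^ 2 * t1 ^ 2 * (s ^ 2) ^ (a + v + 2))
      = t1 ^ 3 * t2 ^ 3 * t3 * t4 * (s ^ 2) ^ (a + v + 2) := by
    field_simp
  have hM : j + u = y + v := by omega
  have hst0 : s * t0 ≠ 0 := mul_ne_zero hs0 h0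
  have hst2 : s * t2 ≠ 0 := mul_ne_zero hs0 h2
  have hD : (s * t0) ^ u / (s * t0) ^ j * ((s * t0) ^ 2) ^ j = (s * t0) ^ (j + u) := by
    field_simp
    ring
  have hE : (s * t2) ^ v * (s * t2) ^ y = (s * t2) ^ (j + u) := by rw [hM]; ring
  have hF : ((s ^ 2) ^ a) ^ y * ((s ^ 2) ^ (a + v + 2)) ^ a
      = ((s ^ 2) ^ (a + (j + u) + 2)) ^ a := by rw [hM]; ring
  rw [hK, hB]
  set P := t3 ^ 2 * t4 ^ 2 * (s ^ 2) ^ (j + u + 1) with hP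
  calc _ = P ^ y * P ^ j * ((s * t2) ^ v * (s * t2) ^ y)
        * ((s * t0) ^ u / (s * t0) ^ j * ((s * t0) ^ 2) ^ j) / (s * t2) ^ a
        * (((s ^ 2) ^ a) ^ y)
        * (t1 * t2 * t3 / t4 * (t4 ^ 2 * t2 ^ 2 * t1 ^ 2 * (s ^ 2) ^ (a + v + 2))) ^ a := by
          simp only [mul_pow]
          ring
    _ = P ^ y * P ^ j * (s * t2) ^ (j + u) * (s * t0) ^ (j + u) / (s * t2) ^ a
        * (t1 ^ 3 * t2 ^ 3 * t3 * t4) ^ a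
        * (((s ^ 2) ^ a) ^ y * ((s ^ 2) ^ (a + v + 2)) ^ a) := by
          rw [hC, hD, hE, mul_pow _ ((s ^ 2) ^ (a + v + 2)) a]
          ring
    _ = _ := by
          rw [hF, pow_add P]
          ring

theorem mono {q s c1 c2 c3 c4 c0 t1 t2 t3 t4 t0 : ℂ} {N j y a u v : ℕ}
    (hs : s ^ 2 = q) (ht1 : t1 ^ 2 = c1) (ht2 : t2 ^ 2 = c2) (ht3 : t3 ^ 2 = c3)
    (ht4 : t4 ^ 2 = c4) (ht0 : t0 ^ 2 = c0)
    (hs0 : s ≠ 0) (h0 : t0 ≠ 0) (h1 : t1 ≠ 0) (h2 : t2 ≠ 0) (h3 : t3 ≠ 0) (h4 : t4 ≠ 0)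
    (hr : s ^ (2 * N + 3) * t0 * t1 * t2 * t3 * t4 = 1)
    (hN : N = a + j + u) (hN' : N = a + y + v) :
    (t3 * t4 / (t0 * t1)) ^ y * (t1 * t2 * t3 / t4) ^ a * ((s * t0) ^ u / (s * t0) ^ j)
      * ((s * t2) ^ v / (s * t2) ^ a) * (c3 * c0 * c4 * q ^ (j + u + 2)) ^ j
      * (c4 * c2 * c1 * q ^ (a + v + 2)) ^ a
    = (t4 * t3 / (t0 * t1)) ^ j * (t1 * t2 * t4 / t3) ^ a * ((s * t0) ^ v / (s * t0) ^ y)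
      * ((s * t2) ^ u / (s * t2) ^ a) * (c4 * c0 * c3 * q ^ (y + v + 2)) ^ y
      * (c3 * c2 * c1 * q ^ (a + u + 2)) ^ a := by
  subst hs ht1 ht2 ht3 ht4 ht0
  have e1 := mono_half (a := a) (j := j) (u := u) (v := v) (y := y) hs0 h0 h1 h2 h4 hr hN hN'
  have e2 := mono_half (t3 := t4) (t4 := t3) (a := a) (j := y) (u := v) (v := u) (y := j) hs0 h0 h1 h2 h3
    (by linear_combination hr) hN' hN
  rw [e1, e2, show j + u = y + v by omega]
  field_simp
  ring

theorem core_half {q s c1 c2 c3 c4 c0 t1 t2 t3 t4 t0 : ℂ} {N j y a u v : ℕ}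
    (hq : q ≠ 0) (hst0 : s * t0 ≠ 0) (hst2 : s * t2 ≠ 0)
    (hr : q ^ (2 * N + 3) * c0 * c1 * c2 * c3 * c4 = 1)
    (hN : N = a + j + u) (hN' : N = a + y + v)
    (hP : poch q q (a + v) ≠ 0)
    (hB : poch q (c2 * c1 * q ^ (a + 1)) (a + u + 1) ≠ 0)
    (hF : poch q (c0 * c3 * q ^ (y + 1)) (N + 1) ≠ 0)
    (hH : poch q (c0 * c3 * q ^ (y + 1)) (y + v + 1) ≠ 0) :
    Lam q s c3 c0 c4 c1 t3 t0 t4 t1 (N : ℤ) (y : ℤ)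
      * (om q (t1 * t2 * t3 / t4) (a : ℤ) * Om q s c3 c0 c4 t0 ((N : ℤ) - (a : ℤ)) (j : ℤ)
        * Om q s c4 c2 c1 t2 ((N : ℤ) - (y : ℤ)) (a : ℤ))
    = poch q q N * poch q q (j + u) / (poch q q a * (poch q q y * poch q q j)
        * (poch q q u * poch q q v))
      * (sg q y * sg q j) * sg q a * ((-1 : ℂ) ^ (a : ℤ) * q ^ ((a : ℤ) * ((a : ℤ) + 1) / 2))
      * (s * t0) ^ N
      * ((1 - c3 * c0 * q ^ (2 * y + 1)) * (1 - c0 * c4 * q ^ (2 * j + 1)))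
      * (1 - c2 * c1 * q ^ (2 * a + 1))
      * (poch q (q * c0) y * poch q (q * c0) j) * poch q (q * c2) a
      * (poch q (q * c3) u * poch q (q * c4) v)
      / (poch q (q * c3) y * poch q (q * c4) j) / poch q (q * c1) a
      * poch q (c2 * c1 * q ^ (a + 1)) (N + 1)
      / (poch q (c2 * c1 * q ^ (a + 1)) (a + u + 1) * poch q (c2 * c1 * q ^ (a + 1)) (a + v + 1))
      / (poch q (c0 * c3 * q ^ (y + 1)) (y + v + 1) * poch q (c0 * c4 * q ^ (j + 1)) (j + u + 1))
      * ((t3 * t4 / (t0 * t1)) ^ y * (t1 * t2 * t3 / t4) ^ a * ((s * t0) ^ u / (s * t0) ^ j)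
      * ((s * t2) ^ v / (s * t2) ^ a) * (c3 * c0 * c4 * q ^ (j + u + 2)) ^ j
      * (c4 * c2 * c1 * q ^ (a + v + 2)) ^ a) := by
  have hA := poch_refl hq (c3 * c0 * c4 * q ^ (j + u + 2)) (c2 * c1 * q ^ (a + 1)) j (a + u + 1)
    (by
      have : q = q * (q ^ (2 * N + 3) * c0 * c1 * c2 * c3 * c4) := by rw [hr, mul_one]
      nth_rewrite 4 [this]
      rw [hN]
      ring)
  rw [show a + u + 1 + j = N + 1 by omega] at hA
  have hD := poch_refl hq (c4 * c2 * c1 * q ^ (a + v + 2)) (c0 * c3 * q ^ (y + 1)) a (y + v + 1)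
    (by
      have : q = q * (q ^ (2 * N + 3) * c0 * c1 * c2 * c3 * c4) := by rw [hr, mul_one]
      nth_rewrite 4 [this]
      rw [hN']
      ring)
  rw [show y + v + 1 + a = N + 1 by omega] at hD
  rw [← eq_div_iff hB] at hA
  rw [← eq_div_iff hH] at hD
  rw [Lam_eq q s c3 c0 c4 c1 t3 t0 t4 t1 N y (a + v) (by omega),
    Om_eq hst0 j u ((N : ℤ) - a) (by push_cast; omega),
    Om_eq hst2 a v ((N : ℤ) - y) (by push_cast; omega), hA, hD,
    show q ^ (y + 1) * c3 * c0 = c0 * c3 * q ^ (y + 1) by ring]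
  unfold om
  rw [zpow_natCast (t1 * t2 * t3 / t4) a]
  generalize poch q (c0 * c3 * q ^ (y + 1)) (N + 1) = F at *
  generalize poch q (c0 * c3 * q ^ (y + 1)) (y + v + 1) = H at *
  generalize poch q (c2 * c1 * q ^ (a + 1)) (a + u + 1) = Bu at *
  generalize poch q (c2 * c1 * q ^ (a + 1)) (a + v + 1) = Bv at *
  generalize poch q (c2 * c1 * q ^ (a + 1)) (N + 1) = C at *
  generalize poch q q (a + v) = Pav at *
  generalize (c3 * c0 * c4 * q ^ (j + u + 2)) ^ j = X1
  generalize (c4 * c2 * c1 * q ^ (a + v + 2)) ^ a = X2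
  generalize (t1 * t2 * t3 / t4) ^ a = X3
  generalize (t3 * t4 / (t0 * t1)) ^ y = X4
  generalize (s * t0) ^ N = X5
  generalize (s * t0) ^ u = X6
  generalize (s * t0) ^ j = X7
  generalize (s * t2) ^ v = X8
  generalize (s * t2) ^ a = X9
  generalize (1 - c3 * c0 * q ^ (2 * y + 1)) = X10
  generalize (1 - c0 * c4 * q ^ (2 * j + 1)) = X11
  generalize (1 - c2 * c1 * q ^ (2 * a + 1)) = X12
  generalize (-1 : ℂ) ^ (a : ℤ) = X13
  generalize q ^ ((a : ℤ) * ((a : ℤ) + 1) / 2) = X14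
  have e1 : F * F⁻¹ = 1 := mul_inv_cancel₀ hF
  have e2 : Pav * Pav⁻¹ = 1 := mul_inv_cancel₀ hP
  simp only [div_eq_mul_inv, mul_inv]
  have hLR : ∀ L R : ℂ, L = R * (F * F⁻¹) * (Pav * Pav⁻¹) → L = R := by
    intro L R h
    rw [h, e1, e2, mul_one, mul_one]
  apply hLR
  ring

theorem pochC_ne {q C : ℂ} {B : ℕ} (hC : ∀ m : ℕ, 1 ≤ m → m ≤ B → 1 - C * q ^ m ≠ 0)
    (e k : ℕ) (he : 1 ≤ e) (hk : e + k ≤ B + 1) : poch q (C * q ^ e) k ≠ 0 := by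
  apply poch_ne
  intro l hl
  rw [mul_assoc, ← pow_add]
  exact hC _ (by omega) (by omega)

theorem nz_of {q C : ℂ} (hq : q ≠ 0) {N : ℕ}
    (h : ∀ k : ℤ, 1 ≤ k → k ≤ 2 * (N : ℤ) + 5 → C ≠ q ^ (-k)) :
    ∀ m : ℕ, 1 ≤ m → m ≤ 2 * N + 5 → 1 - C * q ^ m ≠ 0 := by
  intro m h1 h2 h0
  apply h m (by omega) (by omega)
  rw [zpow_neg, zpow_natCast, eq_comm, inv_eq_iff_eq_inv, ← mul_eq_one_iff_eq_inv₀ (left_ne_zero_of_mul_eq_one (b := q ^ m) (by linear_combination -h0))]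
  linear_combination -h0

theorem core {q s c1 c2 c3 c4 c0 t1 t2 t3 t4 t0 : ℂ} {N j y a : ℕ}
    (hq : q ≠ 0)
    (hs : s ^ 2 = q) (ht1 : t1 ^ 2 = c1) (ht2 : t2 ^ 2 = c2) (ht3 : t3 ^ 2 = c3)
    (ht4 : t4 ^ 2 = c4) (ht0 : t0 ^ 2 = c0)
    (hs0 : s ≠ 0) (h0 : t0 ≠ 0) (h1 : t1 ≠ 0) (h2 : t2 ≠ 0) (h3 : t3 ≠ 0) (h4 : t4 ≠ 0)
    (hr : s ^ (2 * N + 3) * t0 * t1 * t2 * t3 * t4 = 1)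
    (hP : ∀ k, k ≤ N → poch q q k ≠ 0)
    (h12 : ∀ m : ℕ, 1 ≤ m → m ≤ 2 * N + 5 → 1 - (c2 * c1) * q ^ m ≠ 0)
    (h03 : ∀ m : ℕ, 1 ≤ m → m ≤ 2 * N + 5 → 1 - (c0 * c3) * q ^ m ≠ 0)
    (h04 : ∀ m : ℕ, 1 ≤ m → m ≤ 2 * N + 5 → 1 - (c0 * c4) * q ^ m ≠ 0)
    (hj : j + a ≤ N) (hy : y + a ≤ N) :
    Lam q s c3 c0 c4 c1 t3 t0 t4 t1 (N : ℤ) (y : ℤ)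
      * (om q (t1 * t2 * t3 / t4) (a : ℤ) * Om q s c3 c0 c4 t0 ((N : ℤ) - (a : ℤ)) (j : ℤ)
        * Om q s c4 c2 c1 t2 ((N : ℤ) - (y : ℤ)) (a : ℤ))
    = Lam q s c4 c0 c3 c1 t4 t0 t3 t1 (N : ℤ) (j : ℤ)
      * (om q (t1 * t2 * t4 / t3) (a : ℤ) * Om q s c4 c0 c3 t0 ((N : ℤ) - (a : ℤ)) (y : ℤ)
        * Om q s c3 c2 c1 t2 ((N : ℤ) - (j : ℤ)) (a : ℤ)) := by
  obtain ⟨u, hu⟩ := Nat.exists_eq_add_of_le hj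
  obtain ⟨v, hv⟩ := Nat.exists_eq_add_of_le hy
  have hN : N = a + j + u := by omega
  have hN' : N = a + y + v := by omega
  have hrq : q ^ (2 * N + 3) * c0 * c1 * c2 * c3 * c4 = 1 := by
    rw [← hs, ← ht1, ← ht2, ← ht3, ← ht4, ← ht0]
    calc _ = (s ^ (2 * N + 3) * t0 * t1 * t2 * t3 * t4) ^ 2 := by ring
      _ = 1 := by rw [hr, one_pow]
  rw [core_half hq (mul_ne_zero hs0 h0) (mul_ne_zero hs0 h2) hrq hN hN'
      (hP _ (by omega)) (pochC_ne h12 _ _ (by omega) (by omega))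
      (pochC_ne h03 _ _ (by omega) (by omega)) (pochC_ne h03 _ _ (by omega) (by omega)),
    core_half (c3 := c4) (c4 := c3) (t3 := t4) (t4 := t3) hq (mul_ne_zero hs0 h0)
      (mul_ne_zero hs0 h2) (by linear_combination hrq) hN' hN
      (hP _ (by omega)) (pochC_ne h12 _ _ (by omega) (by omega))
      (pochC_ne h04 _ _ (by omega) (by omega)) (pochC_ne h04 _ _ (by omega) (by omega)),
    mono hs ht1 ht2 ht3 ht4 ht0 hs0 h0 h1 h2 h3 h4 hr hN hN',
    show poch q q (j + u) = poch q q (y + v) by rw [show j + u = y + v by omega]]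
  rw [show 1 - c3 * c0 * q ^ (2 * y + 1) = 1 - c0 * c3 * q ^ (2 * y + 1) by ring,
    show 1 - c4 * c0 * q ^ (2 * j + 1) = 1 - c0 * c4 * q ^ (2 * j + 1) by ring,
    mul_comm (poch q q y), mul_comm (poch q q u),
    mul_comm (sg q y), mul_comm (1 - c0 * c3 * q ^ (2 * y + 1)),
    mul_comm (poch q (q * c0) y), mul_comm (poch q (q * c3) u), mul_comm (poch q (q * c3) y),
    mul_comm (poch q (c2 * c1 * q ^ (a + 1)) (a + u + 1)),
    mul_comm (poch q (c0 * c3 * q ^ (y + 1)) (y + v + 1))]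

end qR

/-- Duality of the Griffiths polynomials of q-Racah type. -/
theorem griffiths_duality
    (N : ℕ) (q s c1 c2 c3 c4 c0 t1 t2 t3 t4 t0 : ℂ)
    (hq : q ≠ 0) (hc1 : c1 ≠ 0) (hc2 : c2 ≠ 0) (hc3 : c3 ≠ 0) (hc4 : c4 ≠ 0)
    (hs : s ^ 2 = q) (ht1 : t1 ^ 2 = c1) (ht2 : t2 ^ 2 = c2) (ht3 : t3 ^ 2 = c3)
    (ht4 : t4 ^ 2 = c4)
    (hc0 : c0 = (q ^ (2 * (N : ℤ) + 3) * c1 * c2 * c3 * c4)⁻¹)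
    (ht0 : t0 = (s ^ (2 * (N : ℤ) + 3) * t1 * t2 * t3 * t4)⁻¹)
    (hgen : ∀ e0 e1 e2 e3 e4 : ℕ, e0 ≤ 1 → e1 ≤ 1 → e2 ≤ 1 → e3 ≤ 1 → e4 ≤ 1 →
      1 ≤ e0 + e1 + e2 + e3 + e4 → e0 + e1 + e2 + e3 + e4 ≤ 4 →
      ∀ k : ℤ, 1 ≤ k → k ≤ 2 * (N : ℤ) + 5 →
        c0 ^ e0 * c1 ^ e1 * c2 ^ e2 * c3 ^ e3 * c4 ^ e4 ≠ q ^ (-k))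
    (hq1 : ∀ k : ℕ, 1 ≤ k → k ≤ N → q ^ k ≠ 1)
    (i j x y : ℕ) (hij : i + j ≤ N) (hxy : x + y ≤ N) :
    qR.G q s c1 c2 c3 c4 t1 t2 t3 t4 (N : ℤ) (i : ℤ) (j : ℤ) (x : ℤ) (y : ℤ)
      = qR.Om q s c1 c2 c3 t2 ((N : ℤ) - (j : ℤ)) (i : ℤ)
          * qR.Lam q s c4 c0 c3 c1 t4 t0 t3 t1 (N : ℤ) (j : ℤ)
          / (qR.Om q s c1 c2 c4 t2 ((N : ℤ) - (y : ℤ)) (x : ℤ)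
              * qR.Lam q s c3 c0 c4 c1 t3 t0 t4 t1 (N : ℤ) (y : ℤ))
          * qR.G q s c1 c2 c4 c3 t1 t2 t4 t3 (N : ℤ) (x : ℤ) (y : ℤ) (i : ℤ) (j : ℤ) := by
  have hs0 : s ≠ 0 := by rintro rfl; apply hq; rw [← hs]; simp
  have h1 : t1 ≠ 0 := by rintro rfl; apply hc1; rw [← ht1]; simp
  have h2 : t2 ≠ 0 := by rintro rfl; apply hc2; rw [← ht2]; simp
  have h3 : t3 ≠ 0 := by rintro rfl; apply hc3; rw [← ht3]; simp
  have h4 : t4 ≠ 0 := by rintro rfl; apply hc4; rw [← ht4]; simp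
  have hz : s ^ (2 * (N : ℤ) + 3) = s ^ (2 * N + 3) := by
    rw [← zpow_natCast]; push_cast; rfl
  have hzq : q ^ (2 * (N : ℤ) + 3) = (s ^ (2 * N + 3)) ^ 2 := by
    rw [show 2 * (N : ℤ) + 3 = ((2 * N + 3 : ℕ) : ℤ) by push_cast; rfl, zpow_natCast, ← hs]
    ring
  have h0 : t0 ≠ 0 := by
    rw [ht0]
    exact inv_ne_zero (by simp [h1, h2, h3, h4, zpow_ne_zero _ hs0])
  have ht02 : t0 ^ 2 = c0 := by
    rw [ht0, hc0, hz, hzq, ← ht1, ← ht2, ← ht3, ← ht4, inv_pow]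
    congr 1
    ring
  have hr : s ^ (2 * N + 3) * t0 * t1 * t2 * t3 * t4 = 1 := by
    rw [ht0, hz]
    field_simp
  have hc0' : c0 = (q ^ (2 * (N : ℤ) + 3) * c1 * c2 * c4 * c3)⁻¹ := by
    rw [hc0]; congr 1; ring
  have ht0' : t0 = (s ^ (2 * (N : ℤ) + 3) * t1 * t2 * t4 * t3)⁻¹ := by
    rw [ht0]; congr 1; ring
  have hP : ∀ k, k ≤ N → qR.poch q q k ≠ 0 := by
    intro k hk
    apply qR.poch_ne
    intro l hl h
    apply hq1 (l + 1) (by omega) (by omega)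
    linear_combination -h
  have g12 := qR.nz_of (C := c2 * c1) hq (N := N) (fun k a b => by
    have := hgen 0 1 1 0 0 (by simp) (by simp) (by simp) (by simp) (by simp) (by simp) (by simp) k a b
    simpa [mul_comm] using this)
  have g03 := qR.nz_of (C := c0 * c3) hq (N := N) (fun k a b => by
    simpa using hgen 1 0 0 1 0 (by simp) (by simp) (by simp) (by simp) (by simp) (by simp) (by simp) k a b)
  have g04 := qR.nz_of (C := c0 * c4) hq (N := N) (fun k a b => by
    simpa using hgen 1 0 0 0 1 (by simp) (by simp) (by simp) (by simp) (by simp) (by simp) (by simp) k a b)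
  have g24 := qR.nz_of (C := c2 * c4) hq (N := N) (fun k a b => by
    simpa using hgen 0 0 1 0 1 (by simp) (by simp) (by simp) (by simp) (by simp) (by simp) (by simp) k a b)
  have g124 := qR.nz_of (C := c1 * c2 * c4) hq (N := N) (fun k a b => by
    simpa using hgen 0 1 1 0 1 (by simp) (by simp) (by simp) (by simp) (by simp) (by simp) (by simp) k a b)
  have g0 := qR.nz_of (C := c0) hq (N := N) (fun k a b => by
    simpa using hgen 1 0 0 0 0 (by simp) (by simp) (by simp) (by simp) (by simp) (by simp) (by simp) k a b)
  have g1 := qR.nz_of (C := c1) hq (N := N) (fun k a b => by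
    simpa using hgen 0 1 0 0 0 (by simp) (by simp) (by simp) (by simp) (by simp) (by simp) (by simp) k a b)
  have g2 := qR.nz_of (C := c2) hq (N := N) (fun k a b => by
    simpa using hgen 0 0 1 0 0 (by simp) (by simp) (by simp) (by simp) (by simp) (by simp) (by simp) k a b)
  have g3 := qR.nz_of (C := c3) hq (N := N) (fun k a b => by
    simpa using hgen 0 0 0 1 0 (by simp) (by simp) (by simp) (by simp) (by simp) (by simp) (by simp) k a b)
  have g4 := qR.nz_of (C := c4) hq (N := N) (fun k a b => by
    simpa using hgen 0 0 0 0 1 (by simp) (by simp) (by simp) (by simp) (by simp) (by simp) (by simp) k a b)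
  have hqc : ∀ c : ℂ, q * c = c * q ^ 1 := fun c => by ring
  obtain ⟨w, hw⟩ := Nat.exists_eq_add_of_le hxy
  have hOm : qR.Om q s c1 c2 c4 t2 ((N : ℤ) - (y : ℤ)) (x : ℤ) ≠ 0 := by
    rw [qR.Om_eq (mul_ne_zero hs0 h2) x w ((N : ℤ) - y) (by push_cast; omega)]
    have := hP (x + w) (by omega)
    have := hP x (by omega)
    have := hP w (by omega)
    have := g24 (2 * x + 1) (by omega) (by omega)
    have := qR.pochC_ne g2 1 x (by omega) (by omega)
    have := qR.pochC_ne g124 (x + w + 2) x (by omega) (by omega)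
    have := qR.pochC_ne g1 1 w (by omega) (by omega)
    have := qR.pochC_ne g24 (x + 1) (x + w + 1) (by omega) (by omega)
    have := qR.pochC_ne g4 1 x (by omega) (by omega)
    rw [hqc c1, hqc c2, hqc c4]
    have := pow_ne_zero w (mul_ne_zero hs0 h2)
    have := pow_ne_zero x (mul_ne_zero hs0 h2)
    apply div_ne_zero
    · refine mul_ne_zero (mul_ne_zero (mul_ne_zero (mul_ne_zero (mul_ne_zero
        (div_ne_zero ?_ (mul_ne_zero ?_ ?_)) ?_) ?_) ?_) ?_) ?_ <;> assumption
    · refine mul_ne_zero (mul_ne_zero ?_ ?_) ?_ <;> assumption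
  have hLam : qR.Lam q s c3 c0 c4 c1 t3 t0 t4 t1 (N : ℤ) (y : ℤ) ≠ 0 := by
    rw [qR.Lam_eq q s c3 c0 c4 c1 t3 t0 t4 t1 N y (x + w) (by omega)]
    have := hP N le_rfl
    have := hP y (by omega)
    have := hP (x + w) (by omega)
    have := g03 (2 * y + 1) (by omega) (by omega)
    have := qR.pochC_ne g0 1 y (by omega) (by omega)
    have := qR.pochC_ne g3 1 y (by omega) (by omega)
    have := qR.pochC_ne g03 (y + 1) (N + 1) (by omega) (by omega)
    rw [hqc c0, hqc c3, mul_comm c3 c0,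
      show q ^ (y + 1) * c3 * c0 = c0 * c3 * q ^ (y + 1) by ring]
    have := pow_ne_zero N (mul_ne_zero hs0 h0)
    have : (t3 * t4 / (t0 * t1)) ^ y ≠ 0 :=
      pow_ne_zero y (div_ne_zero (mul_ne_zero h3 h4) (mul_ne_zero h0 h1))
    have : qR.sg q y ≠ 0 := mul_ne_zero (zpow_ne_zero _ (by norm_num)) (zpow_ne_zero _ hq)
    apply div_ne_zero
    · refine mul_ne_zero (mul_ne_zero (mul_ne_zero (mul_ne_zero (mul_ne_zero
        (div_ne_zero ?_ (mul_ne_zero ?_ ?_)) ?_) ?_) ?_) ?_) ?_ <;> assumption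
    · exact mul_ne_zero (by assumption) (by assumption)
  unfold qR.G
  rw [if_pos ⟨by positivity, by positivity, by omega⟩,
    if_pos ⟨by positivity, by positivity, by omega⟩, ← hc0, ← ht0, ← hc0', ← ht0',
    min_comm ((N : ℤ) - y), Finset.mul_sum]
  apply Finset.sum_congr rfl
  intro a ha
  rw [Finset.mem_range] at ha
  have haj : j + a ≤ N := by omega
  have hay : y + a ≤ N := by omega
  have hc := qR.core (j := j) (y := y) (a := a) hq hs ht1 ht2 ht3 ht4 ht02 hs0 h0 h1 h2 h3 h4 hr
    hP g12 g03 g04 haj hay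
  rw [qR.p_eq _ _ _ _ _ _ _ i a (by omega) (by omega),
    qR.p_eq _ _ _ _ _ _ _ j y (by omega) (by omega),
    qR.p_eq _ _ _ _ _ _ _ a x (by omega) (by omega),
    qR.p_eq _ _ _ _ _ _ _ x a (by omega) (by omega),
    qR.p_eq _ _ _ _ _ _ _ y j (by omega) (by omega),
    qR.p_eq _ _ _ _ _ _ _ a i (by omega) (by omega),
    qR.S_symm hq c1 c2 c4 _ x a, qR.S_symm hq c4 c0 c3 _ y j, qR.S_symm hq c3 c2 c1 _ a i]
  rw [div_mul_eq_mul_div, eq_div_iff (mul_ne_zero hOm hLam)]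
  linear_combination (qR.Om q s c1 c2 c4 t2 ((N : ℤ) - (y : ℤ)) (x : ℤ)
    * qR.Om q s c1 c2 c3 t2 ((N : ℤ) - (j : ℤ)) (i : ℤ)
    * qR.S q c1 c2 c3 ((N : ℤ) - j) i a * qR.S q c3 c0 c4 ((N : ℤ) - a) j y
    * qR.S q c4 c2 c1 ((N : ℤ) - y) a x) * hc
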